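/- arXiv:math/9501234 — 2 statements merged into one kernel-verified Lean document; each statement's English description precedes it below -/
import Mathlib

section
/- Let C be a real p×q matrix and D a real r×s matrix. Let M_E be the real square matrix of size pr+qs given in block form by M_E = [[0_{pr}, C⊗D],[Cᵀ⊗Dᵀ, 0_{qs}]], and let M_O be the real square matrix of size ps+qr given by M_O = [[0_{ps}, C⊗Dᵀ],[Cᵀ⊗D, 0_{qr}]]. Then X^{ps+qr} · charpoly(M_E) = X^{pr+qs} · charpoly(M_O) as polynomials; in particular M_E and M_O have the same nonzero eigenvalues with the same multiplicities. -/
open Matrix Kronecker Polynomial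

namespace Matrix

variable {R m n : Type*} [CommRing R] [Fintype m] [Fintype n] [DecidableEq m] [DecidableEq n]

/-- Substituting a polynomial `f` into the characteristic polynomial of `A` gives
`det (f • 1 - A)`. -/
theorem charpoly_comp (A : Matrix n n R) (f : R[X]) :
    A.charpoly.comp f = (scalar n f - A.map Polynomial.C).det := by
  rw [charpoly, ← coe_compRingHom_apply, RingHom.map_det]
  congr 1
  ext i j
  by_cases h : i = j <;> simp [h]

/-- The characteristic polynomial of an off-diagonal block matrix, in terms of the product of its
blocks. -/
theorem charpoly_fromBlocks_zero_zero_mul_X_pow (A : Matrix n m R) (B : Matrix m n R) :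
    (fromBlocks 0 A B 0).charpoly * X ^ Fintype.card n =
      X ^ Fintype.card m * (A * B).charpoly.comp (X ^ 2) := by
  have h : charmatrix (fromBlocks 0 A B 0) *
      fromBlocks (scalar n (X : R[X])) 0 (B.map Polynomial.C) 1 =
      fromBlocks (scalar n ((X : R[X]) ^ 2) - (A * B).map Polynomial.C) (-A.map Polynomial.C)
        0 (scalar m (X : R[X])) := by
    rw [charmatrix_fromBlocks, fromBlocks_multiply]
    simp [charmatrix, Matrix.map_mul, sub_eq_add_neg, pow_two, ← smul_eq_mul_diagonal,
      ← smul_eq_diagonal_mul, ← diagonal_smul, Pi.smul_def]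
  have h' := congrArg det h
  rw [det_mul, det_fromBlocks_zero₁₂, det_fromBlocks_zero₂₁, ← charpoly_comp] at h'
  simpa [charpoly, mul_comm] using h'

end Matrix

/-- Equation (2) at the matrix level: the block matrices `M_E = [[0, C⊗D],[Cᵀ⊗Dᵀ, 0]]`
(of size `pr+qs`) and `M_O = [[0, C⊗Dᵀ],[Cᵀ⊗D, 0]]` (of size `ps+qr`) satisfy
`X^{ps+qr} · charpoly(M_E) = X^{pr+qs} · charpoly(M_O)`; in particular they have the
same nonzero eigenvalues with the same multiplicities. -/
theorem charpoly_blocks_kronecker {p q r s : ℕ}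
    (C : Matrix (Fin p) (Fin q) ℝ) (D : Matrix (Fin r) (Fin s) ℝ) :
    (X : ℝ[X]) ^ (p * s + q * r) *
        Matrix.charpoly (Matrix.fromBlocks 0 (C ⊗ₖ D) (Cᵀ ⊗ₖ Dᵀ) 0)
      = X ^ (p * r + q * s) *
        Matrix.charpoly (Matrix.fromBlocks 0 (C ⊗ₖ Dᵀ) (Cᵀ ⊗ₖ D) 0) := by
  have hE := charpoly_fromBlocks_zero_zero_mul_X_pow (C ⊗ₖ D) (Cᵀ ⊗ₖ Dᵀ)
  have hO := charpoly_fromBlocks_zero_zero_mul_X_pow (C ⊗ₖ Dᵀ) (Cᵀ ⊗ₖ D)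
  have hEO := charpoly_mul_comm' ((1 : Matrix (Fin p) (Fin p) ℝ) ⊗ₖ D) ((C * Cᵀ) ⊗ₖ Dᵀ)
  simp only [← mul_kronecker_mul, one_mul, mul_one] at hE hO hEO
  replace hEO := congrArg (fun f : ℝ[X] => f.comp (X ^ 2)) hEO
  simp only [mul_comp, pow_comp, X_comp, Fintype.card_prod, Fintype.card_fin] at hE hO hEO
  apply mul_right_cancel₀ (pow_ne_zero (p * r + p * s) (X_ne_zero (R := ℝ)))
  linear_combination X ^ (p * s + q * r + p * s) * hE - X ^ (p * r + q * s + p * r) * hO +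
    X ^ (q * r + q * s) * hEO
end

section
/- Let A be a real k×l matrix, B₁ a real a×b matrix, and B₂ a real b×a matrix, with ak ≥ bl. Let M be the real square matrix of size ak+bl given in block form by M = [[0_{ak}, B₁⊗A],[B₂⊗Aᵀ, 0_{bl}]]. Then charpoly(M)(X) = X^{ak−bl} · q(X²), where q is the characteristic polynomial of the bl×bl matrix (B₂B₁) ⊗ (AᵀA). -/
open Matrix Kronecker Polynomial

/-- Substituting `p` into the characteristic polynomial of `N` gives `det (p • 1 - N)`. -/
theorem Matrix.charpoly_comp_s15 {R n : Type*} [CommRing R] [Fintype n] [DecidableEq n]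
    (N : Matrix n n R) (p : R[X]) :
    N.charpoly.comp p = (Matrix.scalar n p - N.map C).det := by
  rw [← coe_compRingHom_apply, charpoly, RingHom.map_det]
  congr 1
  ext1 i j
  by_cases hij : i = j
  · subst hij
    simp
  · simp [hij]

theorem Matrix.X_pow_mul_charpoly_fromBlocks_zero_zero {R m n : Type*} [CommRing R]
    [Fintype m] [DecidableEq m] [Fintype n] [DecidableEq n]
    (P : Matrix m n R) (Q : Matrix n m R) :
    X ^ Fintype.card n * (fromBlocks 0 P Q 0).charpoly =
      X ^ Fintype.card m * (Q * P).charpoly.comp (X ^ 2) := by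
  have hmul : (fromBlocks 0 P Q 0).charmatrix *
      fromBlocks 1 (P.map C) 0 (Matrix.scalar n (X : R[X])) =
      fromBlocks (Matrix.scalar m (X : R[X])) 0 (-Q.map C)
        (Matrix.scalar n (X ^ 2 : R[X]) - (Q * P).map C) := by
    rw [charmatrix_fromBlocks, fromBlocks_multiply, Matrix.map_mul]
    simp only [charmatrix_zero, scalar_apply, ← smul_one_eq_diagonal]
    congr 1 <;> simp [smul_smul, sq, sub_eq_add_neg, add_comm]
  have hdet := congrArg det hmul
  rw [det_mul, det_fromBlocks_zero₂₁, det_fromBlocks_zero₁₂, ← charpoly_comp_s15] at hdet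
  simpa [charpoly, mul_comm] using hdet

theorem Matrix.charpoly_fromBlocks_zero_zero_of_le {R m n : Type*} [CommRing R]
    [Fintype m] [DecidableEq m] [Fintype n] [DecidableEq n]
    (P : Matrix m n R) (Q : Matrix n m R) (hle : Fintype.card n ≤ Fintype.card m) :
    (fromBlocks 0 P Q 0).charpoly =
      X ^ (Fintype.card m - Fintype.card n) * (Q * P).charpoly.comp (X ^ 2) := by
  apply (isRegular_X_pow (Fintype.card n)).left
  simp only
  rw [X_pow_mul_charpoly_fromBlocks_zero_zero, ← mul_assoc, ← pow_add, Nat.add_sub_cancel' hle]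

/-- Equation (10) of the Lemma: for `A` of size `k×l`, `B₁` of size `a×b`, `B₂` of size
`b×a` with `ak ≥ bl`, the block matrix `M = [[0, B₁⊗A],[B₂⊗Aᵀ, 0]]` of size `ak+bl`
satisfies `charpoly(M)(X) = X^{ak−bl} · q(X²)`, where `q` is the characteristic
polynomial of `(B₂B₁) ⊗ (AᵀA)`. -/
theorem charpoly_blocks_eq_X_pow_mul_comp_sq {k l a b : ℕ}
    (A : Matrix (Fin k) (Fin l) ℝ) (B₁ : Matrix (Fin a) (Fin b) ℝ)
    (B₂ : Matrix (Fin b) (Fin a) ℝ) (h : b * l ≤ a * k) :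
    Matrix.charpoly (Matrix.fromBlocks 0 (B₁ ⊗ₖ A) (B₂ ⊗ₖ Aᵀ) 0)
      = X ^ (a * k - b * l) *
        (Matrix.charpoly ((B₂ * B₁) ⊗ₖ (Aᵀ * A))).comp (X ^ 2) := by
  rw [mul_kronecker_mul, charpoly_fromBlocks_zero_zero_of_le _ _ (by simpa using h)]
  simp
end
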